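/- Let φ be the unique ℂ-algebra homomorphism from the free associative unital ℂ-algebra ℂ⟨Y,Z,W⟩ to M₂(ℂ) determined by φ(Y) = [[0,0],[0,1]], φ(Z) = [[0,0],[1,0]], and φ(W) = [[0,1],[0,0]]. Then φ is surjective, and its kernel equals the two-sided ideal generated by the nine elements Y²−Y, Z², W², ZY, YW, ZW−Y, YZ−Z, WY−W, and WZ−1+Y. -/

import Mathlib

noncomputable section

/-- `ℂ⟨Y,Z,W⟩`: the free associative unital ℂ-algebra on three generators. -/
abbrev FAlg : Type := FreeAlgebra ℂ (Fin 3)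

def fY : FAlg := FreeAlgebra.ι ℂ (0 : Fin 3)
def fZ : FAlg := FreeAlgebra.ι ℂ (1 : Fin 3)
def fW : FAlg := FreeAlgebra.ι ℂ (2 : Fin 3)

/-- The defining conditions: `φ(Y) = [[0,0],[0,1]]`, `φ(Z) = [[0,0],[1,0]]`,
`φ(W) = [[0,1],[0,0]]`. -/
def phiConds (φ : FAlg →ₐ[ℂ] Matrix (Fin 2) (Fin 2) ℂ) : Prop :=
  φ fY = !![0, 0; 0, 1] ∧ φ fZ = !![0, 0; 1, 0] ∧ φ fW = !![0, 1; 0, 0]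

/-- Elements `y, z, w` of an algebra which multiply like the matrix units `E₁₁, E₁₀, E₀₁`
determine an algebra homomorphism out of the `2 × 2` matrices. -/
def matrixTwoLift {R A : Type*} [CommRing R] [Ring A] [Algebra R A] (y z w : A)
    (hyy : y * y = y) (hzz : z * z = 0) (hww : w * w = 0) (hzy : z * y = 0) (hyw : y * w = 0)
    (hzw : z * w = y) (hyz : y * z = z) (hwy : w * y = w) (hwz : w * z = 1 - y) :
    Matrix (Fin 2) (Fin 2) R →ₐ[R] A :=
  AlgHom.ofLinearMap
    { toFun := fun M => M 0 0 • (1 - y) + M 0 1 • w + M 1 0 • z + M 1 1 • y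
      map_add' := fun M N => by simp only [Matrix.add_apply]; module
      map_smul' := fun c M => by
        simp only [Matrix.smul_apply, smul_eq_mul, RingHom.id_apply]; module }
    (by simp)
    (fun M N => by
      simp only [LinearMap.coe_mk, AddHom.coe_mk, Matrix.mul_apply, Fin.sum_univ_two, mul_add,
        add_mul, smul_mul_smul_comm, mul_sub, sub_mul, mul_one, one_mul, hyy, hzz, hww, hzy, hyw,
        hzw, hyz, hwy, hwz]
      module)

/-- There is a unique ℂ-algebra homomorphism
`φ : ℂ⟨Y,Z,W⟩ → M₂(ℂ)` with `φ(Y) = [[0,0],[0,1]]`, `φ(Z) = [[0,0],[1,0]]`,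
`φ(W) = [[0,1],[0,0]]`; it is surjective, and its kernel is the two-sided ideal
generated by `Y²−Y, Z², W², ZY, YW, ZW−Y, YZ−Z, WY−W, WZ−1+Y`. -/
theorem stmt_10 :
    (∃! φ : FAlg →ₐ[ℂ] Matrix (Fin 2) (Fin 2) ℂ, phiConds φ) ∧
    ∀ φ : FAlg →ₐ[ℂ] Matrix (Fin 2) (Fin 2) ℂ, phiConds φ →
      Function.Surjective φ ∧
      TwoSidedIdeal.ker φ = TwoSidedIdeal.span
        { fY ^ 2 - fY, fZ ^ 2, fW ^ 2, fZ * fY, fY * fW, fZ * fW - fY,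
          fY * fZ - fZ, fW * fY - fW, fW * fZ - 1 + fY } := by
  refine ⟨⟨FreeAlgebra.lift ℂ ![!![0, 0; 0, 1], !![0, 0; 1, 0], !![0, 1; 0, 0]], ?_, ?_⟩, ?_⟩
  · simp [phiConds, fY, fZ, fW]
  · rintro φ ⟨hY, hZ, hW⟩
    ext1
    funext i
    fin_cases i
    · simpa [fY] using hY
    · simpa [fZ] using hZ
    · simpa [fW] using hW
  rintro φ ⟨hY, hZ, hW⟩
  refine ⟨fun M => ⟨M 0 0 • (1 - fY) + M 0 1 • fW + M 1 0 • fZ + M 1 1 • fY, ?_⟩, ?_⟩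
  · ext i j
    fin_cases i <;> fin_cases j <;> simp [hY, hZ, hW]
  set S : Set FAlg := { fY ^ 2 - fY, fZ ^ 2, fW ^ 2, fZ * fY, fY * fW, fZ * fW - fY,
    fY * fZ - fZ, fW * fY - fW, fW * fZ - 1 + fY } with hS
  apply le_antisymm
  · let c := (TwoSidedIdeal.span S).ringCon
    let π : FAlg →ₐ[ℂ] c.Quotient := c.mkₐ ℂ
    have hπ (x : FAlg) : π x = 0 ↔ x ∈ TwoSidedIdeal.span S := by
      rw [TwoSidedIdeal.mem_iff]
      exact c.eq
    have hrel (x : FAlg) (hx : x ∈ S) : π x = 0 := (hπ x).2 (TwoSidedIdeal.subset_span hx)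
    let ψ : Matrix (Fin 2) (Fin 2) ℂ →ₐ[ℂ] c.Quotient := matrixTwoLift (π fY) (π fZ) (π fW)
        (by simpa [sub_eq_zero] using hrel (fY * fY - fY) (by simp [hS, ← pow_two fY]))
        (by simpa using hrel (fZ * fZ) (by simp [hS, ← pow_two fZ]))
        (by simpa using hrel (fW * fW) (by simp [hS, ← pow_two fW]))
        (by simpa using hrel (fZ * fY) (by simp [hS]))
        (by simpa using hrel (fY * fW) (by simp [hS]))
        (by simpa [sub_eq_zero] using hrel (fZ * fW - fY) (by simp [hS]))
        (by simpa [sub_eq_zero] using hrel (fY * fZ - fZ) (by simp [hS]))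
        (by simpa [sub_eq_zero] using hrel (fW * fY - fW) (by simp [hS]))
        (by simpa [sub_add, sub_eq_zero] using
          hrel (fW * fZ - 1 + fY) (by simp [hS]))
    have hcomp : ψ.comp φ = π := by
      ext1
      funext i
      fin_cases i
      · change ψ (φ fY) = π fY
        simp [hY, ψ, matrixTwoLift]
      · change ψ (φ fZ) = π fZ
        simp [hZ, ψ, matrixTwoLift]
      · change ψ (φ fW) = π fW
        simp [hW, ψ, matrixTwoLift]
    intro x hx
    rw [TwoSidedIdeal.mem_ker] at hx
    rw [← hπ, ← hcomp, AlgHom.comp_apply, hx, map_zero]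
  · rw [TwoSidedIdeal.span_le]
    intro x hx
    rw [SetLike.mem_coe, TwoSidedIdeal.mem_ker]
    rcases hx with rfl | rfl | rfl | rfl | rfl | rfl | rfl | rfl | rfl <;>
      ext i j <;> fin_cases i <;> fin_cases j <;> simp [hY, hZ, hW, sq]
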